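/- Let n > 0 be an odd integer. Then δ(n+1) = δ(n) + (⌊log₂ n⌋ − 2·s₁(n) + 2), as an identity of integers. -/

import Mathlib

/-- Number of D-nodes in the divide-and-conquer tree on `n` leaves:
`δ(1) = 0`, `δ(2m) = 2·δ(m)`, `δ(2m+1) = δ(m) + δ(m+1) + 1`. -/
def delta : ℕ → ℕ
  | 0 => 0
  | 1 => 0
  | n + 2 =>
    if (n + 2) % 2 = 0 then 2 * delta ((n + 2) / 2)
    else delta ((n + 2) / 2) + delta ((n + 2) / 2 + 1) + 1
decreasing_by all_goals (simp_wf; omega)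

/-- Hamming weight of `n`: number of 1s in the binary expansion of `n`. -/
def s1 (n : ℕ) : ℕ := (Nat.digits 2 n).sum

theorem delta_two_mul {m : ℕ} (hm : 0 < m) : delta (2 * m) = 2 * delta m := by
  obtain ⟨k, rfl⟩ : ∃ k, m = k + 1 := ⟨m - 1, by omega⟩
  rw [show 2 * (k + 1) = 2 * k + 2 by ring, delta, if_pos (by omega),
    show (2 * k + 2) / 2 = k + 1 by omega]

theorem delta_two_mul_add_one {m : ℕ} (hm : 0 < m) :
    delta (2 * m + 1) = delta m + delta (m + 1) + 1 := by
  obtain ⟨k, rfl⟩ : ∃ k, m = k + 1 := ⟨m - 1, by omega⟩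
  rw [show 2 * (k + 1) + 1 = (2 * k + 1) + 2 by ring, delta, if_neg (by omega),
    show (2 * k + 1 + 2) / 2 = k + 1 by omega]

theorem s1_two_mul {m : ℕ} (hm : 0 < m) : s1 (2 * m) = s1 m := by
  rw [s1, Nat.digits_def' (by norm_num) (by omega), List.sum_cons, Nat.mul_mod_right,
    Nat.mul_div_cancel_left m (by norm_num), zero_add, s1]

theorem s1_two_mul_add_one (m : ℕ) : s1 (2 * m + 1) = s1 m + 1 := by
  rw [s1, Nat.digits_def' (by norm_num) (by omega), List.sum_cons,
    show (2 * m + 1) % 2 = 1 by omega, show (2 * m + 1) / 2 = m by omega, add_comm, s1]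

theorem log_two_of_div_two_eq {n m : ℕ} (hm : 0 < m) (h : n / 2 = m) :
    Nat.log 2 n = Nat.log 2 m + 1 := by
  rw [Nat.log_of_one_lt_of_le (by norm_num) (by omega), h]

theorem delta_succ {n : ℕ} (hn : 0 < n) :
    (delta (n + 1) : ℤ) = (delta n : ℤ) + ((Nat.log 2 n : ℤ) - 2 * (s1 n : ℤ) + 2) := by
  induction n using Nat.strong_induction_on with
  | _ n ih =>
    obtain rfl | h1 := eq_or_ne n 1
    · simp [delta, s1]
    obtain ⟨m, rfl | rfl⟩ := n.even_or_odd'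
    · have hm : 0 < m := by omega
      have := ih m (by omega) hm
      rw [delta_two_mul_add_one hm, delta_two_mul hm, s1_two_mul hm,
        log_two_of_div_two_eq hm (by omega)]
      push_cast
      linarith
    · have hm : 0 < m := by omega
      have := ih m (by omega) hm
      rw [show 2 * m + 1 + 1 = 2 * (m + 1) by ring, delta_two_mul m.succ_pos,
        delta_two_mul_add_one hm, s1_two_mul_add_one,
        log_two_of_div_two_eq hm (by omega)]
      push_cast
      linarith

theorem delta_succ_of_odd (n : ℕ) (hn : 0 < n) (ho : Odd n) :
    (delta (n + 1) : ℤ) = (delta n : ℤ) + ((Nat.log 2 n : ℤ) - 2 * (s1 n : ℤ) + 2) :=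
  delta_succ hn
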